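/- Let I ⊂ S be a quadratic monomial ideal with linear resolution. Then, after a suitable relabeling of the variables, I has linear quotients with respect to the lexicographic order (induced by x_1 > ... > x_n) on its minimal generators. -/

import Mathlib

open MvPolynomial

/-- `I` has a `d`-linear (free) resolution: there is a resolution
`... → S^{r 2} → S^{r 1} → S^{r 0} → I → 0` in which the generators of `S^{r 0}` map to
homogeneous generators of `I` of degree `d` and all matrices have entries which are
homogeneous of degree `1`.  (Its existence is equivalent to all graded Betti numbers
`β_{i,j}(I)` vanishing for `j ≠ i + d`.) -/
def HasLinearResolution {K : Type*} [Field K] {σ : Type*}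
    (I : Ideal (MvPolynomial σ K)) (d : ℕ) : Prop :=
  ∃ (r : ℕ → ℕ) (g : Fin (r 0) → MvPolynomial σ K)
    (M : (i : ℕ) → Fin (r i) → Fin (r (i + 1)) → MvPolynomial σ K),
    (∀ j, (g j).IsHomogeneous d) ∧
    I = Ideal.span (Set.range g) ∧
    (∀ i j k, (M i j k).IsHomogeneous 1) ∧
    (∀ v : Fin (r 0) → MvPolynomial σ K,
      (∑ j, v j * g j) = 0 ↔
        ∃ w : Fin (r 1) → MvPolynomial σ K, v = fun j => ∑ k, M 0 j k * w k) ∧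
    (∀ (i : ℕ) (v : Fin (r (i + 1)) → MvPolynomial σ K),
      ((fun j => ∑ k, M i j k * v k) = fun _ => 0) ↔
        ∃ w : Fin (r (i + 2)) → MvPolynomial σ K, v = fun k => ∑ l, M (i + 1) k l * w l)

/-- The sign of the variable `i` relative to the set `T` in the Koszul complex. -/
def koszulSign {n : ℕ} (i : Fin n) (T : Finset (Fin n)) : ℤ :=
  (-1) ^ (T.filter (· < i)).card

/-- The Koszul differential of the variables with coefficients in the module `N`, on families
indexed by subsets of the variables. -/
noncomputable def koszulD {K : Type*} [Field K] {n : ℕ} {N : Type*} [AddCommGroup N]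
    [Module (MvPolynomial (Fin n) K) N] (f : Finset (Fin n) → N) (T : Finset (Fin n)) : N :=
  ∑ i ∈ Tᶜ, koszulSign i T • ((X i : MvPolynomial (Fin n) K) • f (insert i T))

section Koszul

variable {K : Type*} [Field K] {n : ℕ}

theorem koszulSign_mul_self (i : Fin n) (T : Finset (Fin n)) :
    koszulSign i T * koszulSign i T = 1 := by
  simp [koszulSign, ← mul_pow]

theorem koszulSign_insert_of_lt {i m : Fin n} {T : Finset (Fin n)} (hm : m ∉ T) (h : m < i) :
    koszulSign i (insert m T) = -koszulSign i T := by
  simp [koszulSign, Finset.filter_insert, h, hm, pow_succ]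

theorem koszulSign_insert_of_not_lt {i m : Fin n} {T : Finset (Fin n)} (h : ¬ m < i) :
    koszulSign i (insert m T) = koszulSign i T := by
  simp [koszulSign, Finset.filter_insert, h]

theorem koszulSign_of_le {i : Fin n} {T : Finset (Fin n)} (h : ∀ j ∈ T, i ≤ j) :
    koszulSign i T = 1 := by
  have : T.filter (· < i) = ∅ := by
    rw [Finset.filter_eq_empty_iff]
    exact fun j hj => not_lt.mpr (h j hj)
  simp [koszulSign, this]

theorem koszulSign_swap {i j : Fin n} {T : Finset (Fin n)} (hi : i ∉ T) (hj : j ∉ T)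
    (hij : i ≠ j) :
    koszulSign i T * koszulSign j (insert i T) =
      -(koszulSign j T * koszulSign i (insert j T)) := by
  rcases lt_or_gt_of_ne hij with h | h
  · rw [koszulSign_insert_of_lt hi h, koszulSign_insert_of_not_lt h.not_gt]; ring
  · rw [koszulSign_insert_of_lt hj h, koszulSign_insert_of_not_lt h.not_gt]; ring

variable {N N' : Type*} [AddCommGroup N] [Module (MvPolynomial (Fin n) K) N]
  [AddCommGroup N'] [Module (MvPolynomial (Fin n) K) N']

theorem koszulD_map (φ : N →ₗ[MvPolynomial (Fin n) K] N') (f : Finset (Fin n) → N)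
    (T : Finset (Fin n)) :
    koszulD (K := K) (fun U => φ (f U)) T = φ (koszulD (K := K) f T) := by
  simp [koszulD, map_sum, map_zsmul]

theorem koszulD_sub (f g : Finset (Fin n) → N) (T : Finset (Fin n)) :
    koszulD (K := K) (fun U => f U - g U) T = koszulD (K := K) f T - koszulD (K := K) g T := by
  simp [koszulD, smul_sub, Finset.sum_sub_distrib]

theorem koszulD_koszulD (f : Finset (Fin n) → N) (T : Finset (Fin n)) :
    koszulD (K := K) (koszulD (K := K) f) T = 0 := by
  have key : koszulD (K := K) (koszulD (K := K) f) T =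
      ∑ p ∈ (Tᶜ).sigma (fun i => (insert i T)ᶜ),
        (koszulSign p.1 T * koszulSign p.2 (insert p.1 T)) •
          ((X p.1 * X p.2 : MvPolynomial (Fin n) K) • f (insert p.2 (insert p.1 T))) := by
    rw [Finset.sum_sigma]
    unfold koszulD
    refine Finset.sum_congr rfl fun i _ => ?_
    rw [Finset.smul_sum, Finset.smul_sum]
    refine Finset.sum_congr rfl fun j _ => ?_
    rw [mul_smul, mul_smul, smul_comm (X i : MvPolynomial (Fin n) K) (koszulSign j (insert i T))]
  rw [key]
  refine Finset.sum_involution (fun p _ => ⟨p.2, p.1⟩) ?_ ?_ ?_ ?_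
  · rintro ⟨i, j⟩ h
    simp only [Finset.mem_sigma, Finset.mem_compl, Finset.mem_insert, not_or] at h
    rw [koszulSign_swap h.1 h.2.2 (Ne.symm h.2.1), Finset.insert_comm j i,
      mul_comm (X i : MvPolynomial (Fin n) K)]
    simp
  · rintro ⟨i, j⟩ h _ h'
    simp only [Finset.mem_sigma, Finset.mem_compl, Finset.mem_insert, not_or] at h
    simp only [Sigma.mk.injEq] at h'
    exact h.2.1 h'.1
  · rintro ⟨i, j⟩ h
    simp only [Finset.mem_sigma, Finset.mem_compl, Finset.mem_insert, not_or] at h ⊢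
    exact ⟨h.2.2, Ne.symm h.2.1, h.1⟩
  · rintro ⟨i, j⟩ h
    rfl

theorem coeff_koszulD (f : Finset (Fin n) → MvPolynomial (Fin n) K) (T : Finset (Fin n))
    (b : Fin n →₀ ℕ) :
    coeff b (koszulD (K := K) f T) = ∑ i ∈ Tᶜ, koszulSign i T •
      (if i ∈ b.support then coeff (b - Finsupp.single i 1) (f (insert i T)) else 0) := by
  classical
  simp only [koszulD, coeff_sum]
  refine Finset.sum_congr rfl fun i _ => ?_
  rw [smul_eq_mul, ← coeff_X_mul']
  exact map_zsmul (lcoeff K b) _ _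

theorem exists_coeff_eq_ite (p : MvPolynomial (Fin n) K) (P : (Fin n →₀ ℕ) → Prop)
    [DecidablePred P] :
    ∃ q : MvPolynomial (Fin n) K, ∀ b, coeff b q = if P b then coeff b p else 0 := by
  classical
  refine ⟨∑ b ∈ p.support.filter P, monomial b (coeff b p), fun b => ?_⟩
  simp only [coeff_sum, coeff_monomial, Finset.sum_ite_eq', Finset.mem_filter, mem_support_iff]
  by_cases h : coeff b p = 0 <;> simp [h]

/-- The Koszul complex of the variables of a polynomial ring is exact away from the constants. -/
theorem exists_eq_koszulD (f : Finset (Fin n) → MvPolynomial (Fin n) K)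
    (hf : ∀ T, koszulD (K := K) f T = 0) (h0 : coeff 0 (f ∅) = 0) :
    ∃ y : Finset (Fin n) → MvPolynomial (Fin n) K, ∀ T, f T = koszulD (K := K) y T := by
  classical
  have hy : ∀ U : Finset (Fin n), ∃ q : MvPolynomial (Fin n) K, ∀ m ∈ U, (∀ j ∈ U, m ≤ j) →
      ∀ b, coeff b q = if ∀ k ∈ b.support, m ≤ k then
        coeff (b + Finsupp.single m 1) (f (U.erase m)) else 0 := by
    intro U
    by_cases hU : ∃ m ∈ U, ∀ j ∈ U, m ≤ j
    · obtain ⟨m, hm, hmin⟩ := hU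
      obtain ⟨q, hq⟩ := exists_coeff_eq_ite ((f (U.erase m)).divMonomial (Finsupp.single m 1))
        (fun b => ∀ k ∈ b.support, m ≤ k)
      refine ⟨q, fun m' hm' hmin' b => ?_⟩
      obtain rfl : m = m' := le_antisymm (hmin _ hm') (hmin' _ hm)
      rw [hq, coeff_divMonomial, add_comm]
    · exact ⟨0, fun m hm hmin => absurd ⟨m, hm, hmin⟩ hU⟩
  choose y hy using hy
  refine ⟨y, fun T => ?_⟩
  ext b
  rw [coeff_koszulD]
  by_cases hne : (T ∪ b.support).Nonempty
  · set m := (T ∪ b.support).min' hne with hmdef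
    have hm : ∀ j, j ∈ T ∨ j ∈ b.support → m ≤ j := fun j hj =>
      Finset.min'_le _ _ (Finset.mem_union.mpr hj)
    have hmem : m ∈ T ∨ m ∈ b.support := Finset.mem_union.mp (Finset.min'_mem _ hne)
    clear_value m
    by_cases hmT : m ∈ T
    · have hz := congrArg (coeff (b + Finsupp.single m 1)) (hf (T.erase m))
      rw [coeff_koszulD, coeff_zero, Finset.compl_erase,
        Finset.sum_insert (by simpa using hmT), Finset.insert_erase hmT,
        koszulSign_of_le fun j hj => hm j (.inl (Finset.mem_of_mem_erase hj))] at hz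
      simp only [one_smul, add_tsub_cancel_right] at hz
      rw [if_pos (by simp)] at hz
      rw [eq_neg_of_add_eq_zero_left hz, ← Finset.sum_neg_distrib]
      refine Finset.sum_congr rfl fun i hi => ?_
      have hiT : i ∉ T := Finset.mem_compl.mp hi
      have him : i ≠ m := fun h => hiT (h ▸ hmT)
      have hi' : i ∈ (b + Finsupp.single m 1).support ↔ i ∈ b.support := by
        simp [him.symm]
      simp only [hi']
      by_cases hib : i ∈ b.support
      · have hmi : m < i := lt_of_le_of_ne (hm i (.inr hib)) him.symm
        have hs : koszulSign i T = -koszulSign i (T.erase m) := by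
          conv_lhs => rw [← Finset.insert_erase hmT]
          exact koszulSign_insert_of_lt (Finset.notMem_erase m T) hmi
        have hle : ∀ k ∈ (b - Finsupp.single i 1).support, m ≤ k := fun k hk =>
          hm k (.inr (Finsupp.support_mono tsub_le_self hk))
        have hbi : Finsupp.single i 1 ≤ b := by
          rw [Finsupp.single_le_iff]
          exact Nat.one_le_iff_ne_zero.mpr (Finsupp.mem_support_iff.mp hib)
        rw [if_pos hib, if_pos hib, hy (insert i T) m (Finset.mem_insert_of_mem hmT)
          (by
            intro j hj
            rcases Finset.mem_insert.mp hj with rfl | hj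
            · exact hmi.le
            · exact hm j (.inl hj)), if_pos hle, hs, neg_smul,
          Finset.erase_insert_of_ne him, tsub_add_eq_add_tsub hbi]
      · simp [hib]
    · have hmb : m ∈ b.support := hmem.resolve_left hmT
      rw [Finset.sum_eq_single m]
      · rw [if_pos hmb, koszulSign_of_le fun j hj => hm j (.inl hj), one_smul,
          hy (insert m T) m (Finset.mem_insert_self _ _)
          (by
            intro j hj
            rcases Finset.mem_insert.mp hj with rfl | hj
            · exact le_rfl
            · exact hm j (.inl hj)), if_pos fun k hk =>
              hm k (.inr (Finsupp.support_mono tsub_le_self hk)), Finset.erase_insert hmT,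
          tsub_add_cancel_of_le]
        rw [Finsupp.single_le_iff]
        exact Nat.one_le_iff_ne_zero.mpr (Finsupp.mem_support_iff.mp hmb)
      · intro i hi him
        by_cases hib : i ∈ b.support
        · have hiT : i ∉ T := Finset.mem_compl.mp hi
          rw [if_pos hib]
          have hne' : (insert i T).Nonempty := Finset.insert_nonempty _ _
          have hmin := (insert i T).min'_mem hne'
          rw [hy (insert i T) _ hmin fun j hj => Finset.min'_le _ _ hj, if_neg, smul_zero]
          intro hall
          have h1 := hall m (by
            rw [Finsupp.mem_support_iff] at hmb ⊢
            simpa [Finsupp.single_apply, him] using hmb)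
          rcases Finset.mem_insert.mp hmin with h | h
          · rw [h] at h1
            exact him (le_antisymm h1 (hm i (.inr hib)))
          · exact hmT (le_antisymm h1 (hm _ (.inl h)) ▸ h)
        · simp [hib]
      · intro h
        exact absurd (Finset.mem_compl.mpr hmT) h
  · rw [Finset.not_nonempty_iff_eq_empty, Finset.union_eq_empty] at hne
    obtain ⟨rfl, hb⟩ := hne
    obtain rfl : b = 0 := Finsupp.support_eq_empty.mp hb
    simp [h0]

theorem koszulD_apply {ι : Type*} (f : Finset (Fin n) → ι → MvPolynomial (Fin n) K)
    (T : Finset (Fin n)) (k : ι) :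
    koszulD (K := K) f T k = koszulD (K := K) (fun U => f U k) T := by
  simp [koszulD, Finset.sum_apply, mul_left_comm]

theorem exists_eq_koszulD_pi {ι : Type*} (f : Finset (Fin n) → ι → MvPolynomial (Fin n) K)
    (hf : ∀ T, koszulD (K := K) f T = 0) (h0 : ∀ k, coeff 0 (f ∅ k) = 0) :
    ∃ y : Finset (Fin n) → ι → MvPolynomial (Fin n) K, ∀ T, f T = koszulD (K := K) y T := by
  have h : ∀ k, ∃ y : Finset (Fin n) → MvPolynomial (Fin n) K, ∀ T,
      f T k = koszulD (K := K) y T := fun k =>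
    exists_eq_koszulD (fun T => f T k) (fun T => by rw [← koszulD_apply, hf]; rfl) (h0 k)
  choose y hy using h
  refine ⟨fun T k => y k T, fun T => funext fun k => ?_⟩
  rw [hy k T, koszulD_apply]

end Koszul

section LinearResolution

variable {K : Type*} [Field K] {n : ℕ}

theorem homogeneousComponent_mul_of_isHomogeneous {σ : Type*} {d : ℕ} {p : MvPolynomial σ K}
    (hp : p.IsHomogeneous d) (w : MvPolynomial σ K) :
    homogeneousComponent d (p * w) = p * C (coeff 0 w) := by
  conv_lhs => rw [← sum_homogeneousComponent w, Finset.mul_sum, map_sum]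
  rw [Finset.sum_eq_single 0]
  · rw [homogeneousComponent_of_mem (n := d + 0)
      (hp.mul (homogeneousComponent_isHomogeneous 0 w)), homogeneousComponent_zero]
    simp
  · intro k _ hk
    rw [homogeneousComponent_of_mem (n := d + k)
      (hp.mul (homogeneousComponent_isHomogeneous k w)), if_neg (by omega)]
  · simp

theorem sum_mul_sub_constant {κ σ : Type*} [Fintype κ] {d : ℕ} {m : κ → MvPolynomial σ K}
    (hm : ∀ k, (m k).IsHomogeneous d) {w : κ → MvPolynomial σ K}
    (hw : homogeneousComponent d (∑ k, m k * w k) = 0) :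
    ∑ k, m k * (w k - C (coeff 0 (w k))) = ∑ k, m k * w k := by
  simp only [mul_sub, Finset.sum_sub_distrib]
  rw [map_sum, Finset.sum_congr rfl fun k _ =>
    homogeneousComponent_mul_of_isHomogeneous (hm k) (w k)] at hw
  rw [hw, sub_zero]

theorem homogeneousComponent_one_koszulD (f : Finset (Fin n) → MvPolynomial (Fin n) K)
    (hf : ∀ T, coeff 0 (f T) = 0) (T : Finset (Fin n)) :
    homogeneousComponent 1 (koszulD (K := K) f T) = 0 := by
  unfold koszulD
  rw [map_sum]
  refine Finset.sum_eq_zero fun i _ => ?_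
  rw [map_zsmul, smul_eq_mul, homogeneousComponent_mul_of_isHomogeneous (isHomogeneous_X K i), hf]
  simp

theorem koszulD_eq_zero_of_card {N : Type*} [AddCommGroup N] [Module (MvPolynomial (Fin n) K) N]
    {f : Finset (Fin n) → N} {p : ℕ} (hf : ∀ T, p + 1 ≤ T.card → f T = 0)
    {T : Finset (Fin n)} (hT : p ≤ T.card) : koszulD (K := K) f T = 0 := by
  refine Finset.sum_eq_zero fun i hi => ?_
  rw [hf _ (by rw [Finset.card_insert_of_notMem (Finset.mem_compl.mp hi)]; omega)]
  simp

/-- In a linear complex of free modules `F i` that is exact in positive degrees, a Koszul chain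
without constant terms that is a cycle modulo the image of `F (i + 1)` is a boundary modulo
that image. -/
theorem exists_eq_koszulD_add_of_linear {r : ℕ → ℕ}
    {M : (i : ℕ) → Fin (r i) → Fin (r (i + 1)) → MvPolynomial (Fin n) K}
    (hM : ∀ i j k, (M i j k).IsHomogeneous 1)
    (hex : ∀ i v, (Matrix.of (M i)).mulVecLin v = 0 ↔
      ∃ w, v = (Matrix.of (M (i + 1))).mulVecLin w)
    (p i : ℕ) (Z : Finset (Fin n) → Fin (r i) → MvPolynomial (Fin n) K)
    (hcard : ∀ T, p ≤ T.card → Z T = 0) (hZ : ∀ T k, coeff 0 (Z T k) = 0)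
    (hcyc : ∀ T, ∃ w, koszulD (K := K) Z T = (Matrix.of (M i)).mulVecLin w) :
    ∃ (Y : Finset (Fin n) → Fin (r i) → MvPolynomial (Fin n) K)
      (V : Finset (Fin n) → Fin (r (i + 1)) → MvPolynomial (Fin n) K),
      ∀ T, Z T = koszulD (K := K) Y T + (Matrix.of (M i)).mulVecLin (V T) := by
  induction p generalizing i with
  | zero =>
    refine ⟨fun _ => 0, fun _ => 0, fun T => ?_⟩
    rw [hcard T (Nat.zero_le _)]
    simp [koszulD]
  | succ p ih =>
    have hlift : ∀ T, ∃ w, (p ≤ T.card → w = 0) ∧ (∀ k, coeff 0 (w k) = 0) ∧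
        koszulD (K := K) Z T = (Matrix.of (M i)).mulVecLin w := by
      intro T
      by_cases hT : p ≤ T.card
      · exact ⟨0, fun _ => rfl, by simp, by
          rw [koszulD_eq_zero_of_card hcard hT, map_zero]⟩
      · obtain ⟨w, hw⟩ := hcyc T
        refine ⟨fun k => w k - C (coeff 0 (w k)), fun h => absurd h hT, by simp, ?_⟩
        rw [hw]
        funext j
        refine (sum_mul_sub_constant (hM i j) ?_).symm
        have := homogeneousComponent_one_koszulD (fun T => Z T j) (fun T => hZ T j) T
        rwa [← koszulD_apply, hw] at this
    choose Z' hcard' hZ' hD using hlift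
    obtain ⟨Y', V', hY'⟩ := ih (i + 1) Z' hcard' hZ' fun T => (hex i _).mp (by
      rw [← koszulD_map, ← funext hD, koszulD_koszulD])
    have hcomp : ∀ v, (Matrix.of (M i)).mulVecLin ((Matrix.of (M (i + 1))).mulVecLin v) = 0 :=
      fun v => (hex i _).mpr ⟨v, rfl⟩
    obtain ⟨Y, hY⟩ := exists_eq_koszulD_pi (K := K)
      (fun T => Z T - (Matrix.of (M i)).mulVecLin (Y' T)) (fun T => by
        rw [koszulD_sub, koszulD_map, hD, hY', map_add, hcomp]
        simp) (fun k => by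
        have h : coeff 0 (∑ l, M i k l * Y' ∅ l) = 0 := by
          rw [coeff_sum]
          refine Finset.sum_eq_zero fun l _ => ?_
          rw [← constantCoeff_eq, map_mul, constantCoeff_eq,
            (hM i k l).coeff_eq_zero (by simp), zero_mul]
        rw [Pi.sub_apply, coeff_sub, hZ, zero_sub, neg_eq_zero]
        exact h)
    exact ⟨Y, Y', fun T => by rw [← hY, sub_add_cancel]⟩

/-- Vanishing of the Koszul homology of `S / I` off the linear strand, for an ideal `I` with
`d`-linear resolution. -/
theorem HasLinearResolution.exists_sub_koszulD_mem {I : Ideal (MvPolynomial (Fin n) K)} {d : ℕ}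
    (hI : HasLinearResolution I d) (hd : d ≠ 0)
    (u : Finset (Fin n) → MvPolynomial (Fin n) K) (hu : ∀ T, (u T).IsHomogeneous d)
    (hcyc : ∀ T, koszulD (K := K) u T ∈ I) :
    ∃ y : Finset (Fin n) → MvPolynomial (Fin n) K, ∀ T, u T - koszulD (K := K) y T ∈ I := by
  obtain ⟨r, g, M, hg, rfl, hM, hex0, hex⟩ := hI
  set ψ := Fintype.linearCombination (MvPolynomial (Fin n) K) g with hψ
  have hψ_apply : ∀ w, ψ w = ∑ j, w j * g j := fun w => by
    simp [hψ, Fintype.linearCombination_apply]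
  have hψ_mem : ∀ w, ψ w ∈ Ideal.span (Set.range g) := fun w => by
    rw [hψ_apply]
    exact Ideal.sum_mem _ fun j _ => Ideal.mul_mem_left _ _ (Ideal.subset_span ⟨j, rfl⟩)
  have hex0' : ∀ v, ψ v = 0 ↔ ∃ w, v = (Matrix.of (M 0)).mulVecLin w := fun v => by
    rw [hψ_apply]
    exact hex0 v
  have hlift : ∀ T, ∃ w : Fin (r 0) → MvPolynomial (Fin n) K, (∀ k, coeff 0 (w k) = 0) ∧
      koszulD (K := K) u T = ψ w := by
    intro T
    obtain ⟨w, hw⟩ := Ideal.mem_span_range_iff_exists_fun.mp (hcyc T)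
    refine ⟨fun k => w k - C (coeff 0 (w k)), by simp, ?_⟩
    have hcomp : homogeneousComponent d (koszulD (K := K) u T) = 0 := by
      unfold koszulD
      rw [map_sum]
      refine Finset.sum_eq_zero fun i _ => ?_
      rw [map_zsmul, smul_eq_mul, homogeneousComponent_of_mem (n := 1 + d)
        ((isHomogeneous_X K i).mul (hu _)), if_neg (by omega), smul_zero]
    rw [hψ_apply]
    simp only [mul_comm _ (g _)] at hw ⊢
    rw [sum_mul_sub_constant hg (by rw [hw, hcomp]), hw]
  choose Z hZ hD using hlift
  have hZcyc : ∀ T, ∃ w, koszulD (K := K) Z T = (Matrix.of (M 0)).mulVecLin w := fun T =>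
    (hex0' _).mp (by rw [← koszulD_map, ← funext hD, koszulD_koszulD])
  obtain ⟨Y, V, hYV⟩ := exists_eq_koszulD_add_of_linear hM hex (n + 1) 0 Z
    (fun T hT => absurd (T.card_le_univ.trans_eq (Fintype.card_fin n)) (by omega)) hZ hZcyc
  obtain ⟨y, hy⟩ := exists_eq_koszulD (K := K) (fun T => u T - ψ (Y T))
    (fun T => by
      rw [koszulD_sub, koszulD_map, hD, hYV, map_add, (hex0' _).mpr ⟨V T, rfl⟩]
      simp)
    (by
      rw [coeff_sub, hψ_apply, coeff_sum, (hu ∅).coeff_eq_zero (by simpa using hd.symm), zero_sub,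
        neg_eq_zero]
      refine Finset.sum_eq_zero fun l _ => ?_
      rw [← constantCoeff_eq, map_mul, constantCoeff_eq,
        (hg l).coeff_eq_zero (by simpa using hd.symm), mul_zero])
  exact ⟨y, fun T => by rw [← hy, sub_sub_cancel]; exact hψ_mem _⟩

end LinearResolution

section QuadraticMonomialIdeal

variable {K : Type*} [Field K] {n : ℕ}

/-- The exponent vector of the monomial `x_i x_j`. -/
noncomputable def quadric (i j : Fin n) : Fin n →₀ ℕ :=
  Finsupp.single i 1 + Finsupp.single j 1

theorem quadric_comm (i j : Fin n) : quadric i j = quadric j i := add_comm _ _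

theorem quadric_apply (i j k : Fin n) :
    quadric i j k = (if i = k then 1 else 0) + if j = k then 1 else 0 := by
  simp [quadric, Finsupp.single_apply]

theorem mem_support_quadric {i j k : Fin n} : k ∈ (quadric i j).support ↔ k = i ∨ k = j := by
  rw [Finsupp.mem_support_iff, quadric_apply]
  grind

theorem degree_quadric (i j : Fin n) : (quadric i j).degree = 2 := by
  simp [quadric]

theorem quadric_sub_left (i j : Fin n) : quadric i j - Finsupp.single i 1 = Finsupp.single j 1 :=
  add_tsub_cancel_left _ _

theorem quadric_sub_right (i j : Fin n) : quadric i j - Finsupp.single j 1 = Finsupp.single i 1 :=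
  add_tsub_cancel_right _ _

theorem eq_or_eq_of_quadric_eq {a b c d : Fin n} (h : quadric a b = quadric c d) :
    (a = c ∧ b = d) ∨ (a = d ∧ b = c) := by
  have h1 := DFunLike.congr_fun h a
  have h2 := DFunLike.congr_fun h b
  have h3 := DFunLike.congr_fun h c
  simp only [quadric_apply] at h1 h2 h3
  grind

theorem exists_eq_quadric {a : Fin n →₀ ℕ} (h : a.degree = 2) : ∃ i j, a = quadric i j := by
  have step : ∀ (b : Fin n →₀ ℕ) (m : ℕ), b.degree = m + 1 →
      ∃ i c, b = Finsupp.single i 1 + c ∧ c.degree = m := by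
    intro b m hb
    obtain ⟨i, hi⟩ : ∃ i, b i ≠ 0 := by
      by_contra! hall
      obtain rfl : b = 0 := Finsupp.ext hall
      simp at hb
    have hle : Finsupp.single i 1 ≤ b := by
      rw [Finsupp.single_le_iff]
      exact Nat.one_le_iff_ne_zero.mpr hi
    have hsum := (add_tsub_cancel_of_le hle).symm
    refine ⟨i, b - Finsupp.single i 1, hsum, ?_⟩
    rw [hsum, map_add, Finsupp.degree_single] at hb
    omega
  obtain ⟨i, c, rfl, hc⟩ := step a 1 h
  obtain ⟨j, e, rfl, he⟩ := step c 0 hc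
  rw [Finsupp.degree_eq_zero_iff] at he
  exact ⟨i, j, by rw [he, add_zero, quadric]⟩

variable {A : Set (Fin n →₀ ℕ)}

theorem coeff_eq_zero_of_mem_span_of_notMem (hA : ∀ a ∈ A, a.degree = 2)
    {p : MvPolynomial (Fin n) K}
    (hp : p ∈ Ideal.span ((fun a => (monomial a (1 : K) : MvPolynomial (Fin n) K)) '' A))
    {b : Fin n →₀ ℕ} (hb : b.degree = 2) (hbA : b ∉ A) : coeff b p = 0 := by
  by_contra hne
  obtain ⟨a, ha, hle⟩ := mem_ideal_span_monomial_image.mp hp b (mem_support_iff.mpr hne)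
  obtain ⟨c, rfl⟩ := exists_add_of_le hle
  rw [map_add, hA a ha] at hb
  have : c = 0 := (Finsupp.degree_eq_zero_iff c).mp (by omega)
  exact hbA (by simpa [this] using ha)

theorem X_mul_monomial_quadric_mem {c i j : Fin n}
    (h : quadric i j ∈ A ∨ quadric i c ∈ A ∨ quadric j c ∈ A) :
    X c * monomial (quadric i j) (1 : K) ∈
      Ideal.span ((fun a => (monomial a (1 : K) : MvPolynomial (Fin n) K)) '' A) := by
  rw [X, monomial_mul, mem_ideal_span_monomial_image]
  intro b hb
  obtain rfl : b = Finsupp.single c 1 + quadric i j := by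
    simpa using support_monomial_subset hb
  rcases h with h | h | h
  · exact ⟨_, h, le_add_self⟩
  · refine ⟨_, h, ?_⟩
    rw [quadric, quadric, add_comm, add_le_add_iff_left]
    exact le_self_add
  · refine ⟨_, h, ?_⟩
    rw [quadric, quadric, add_comm, add_le_add_iff_left]
    exact le_add_self

/-- The Koszul relation obtained from the chain `x_i x_j e_U` that is a cycle modulo `I`. -/
theorem exists_koszulD_coeff (hA : ∀ a ∈ A, a.degree = 2)
    (hI : HasLinearResolution
      (Ideal.span ((fun a => (monomial a (1 : K) : MvPolynomial (Fin n) K)) '' A)) 2)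
    {U : Finset (Fin n)} {i j : Fin n}
    (hU : ∀ c ∈ U, quadric i j ∈ A ∨ quadric i c ∈ A ∨ quadric j c ∈ A) :
    ∃ y : Finset (Fin n) → MvPolynomial (Fin n) K, ∀ T c d, quadric c d ∉ A →
      coeff (quadric c d) (koszulD (K := K) y T) =
        if T = U ∧ quadric i j = quadric c d then 1 else 0 := by
  classical
  obtain ⟨y, hy⟩ := hI.exists_sub_koszulD_mem two_ne_zero
    (fun T => if T = U then monomial (quadric i j) 1 else 0)
    (fun T => by
      split_ifs
      · exact isHomogeneous_monomial _ (degree_quadric i j)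
      · exact isHomogeneous_zero _ _ _)
    (fun T => by
      refine Ideal.sum_mem _ fun c _ => zsmul_mem ?_ _
      beta_reduce
      split_ifs with h
      · exact X_mul_monomial_quadric_mem (hU c (h ▸ Finset.mem_insert_self _ _))
      · simp)
  refine ⟨y, fun T c d hcd => ?_⟩
  have h := coeff_eq_zero_of_mem_span_of_notMem hA (hy T) (degree_quadric c d) hcd
  rw [coeff_sub, sub_eq_zero] at h
  rw [← h]
  by_cases hT : T = U <;> simp [hT, coeff_monomial]

theorem koszulD_coeff_quadric (y : Finset (Fin n) → MvPolynomial (Fin n) K) {T : Finset (Fin n)}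
    {c d : Fin n} (hc : c ∉ T) (hd : d ∉ T) (hcd : c ≠ d) :
    coeff (quadric c d) (koszulD (K := K) y T) =
      koszulSign c T • coeff (Finsupp.single d 1) (y (insert c T)) +
        koszulSign d T • coeff (Finsupp.single c 1) (y (insert d T)) := by
  rw [coeff_koszulD, Finset.sum_eq_add c d hcd]
  · rw [if_pos (mem_support_quadric.mpr (.inl rfl)), if_pos (mem_support_quadric.mpr (.inr rfl)),
      quadric_sub_left, quadric_sub_right]
  · intro i _ hi
    rw [if_neg (by rw [mem_support_quadric]; tauto), smul_zero]
  · exact fun h => absurd (Finset.mem_compl.mpr hc) h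
  · exact fun h => absurd (Finset.mem_compl.mpr hd) h

theorem koszulD_coeff_quadric_of_mem (y : Finset (Fin n) → MvPolynomial (Fin n) K)
    {T : Finset (Fin n)} {c d : Fin n} (hc : c ∈ T) (hd : d ∉ T) :
    coeff (quadric c d) (koszulD (K := K) y T) =
      koszulSign d T • coeff (Finsupp.single c 1) (y (insert d T)) := by
  rw [coeff_koszulD, Finset.sum_eq_single d]
  · rw [if_pos (mem_support_quadric.mpr (.inr rfl)), quadric_sub_right]
  · intro i hi hid
    rw [if_neg, smul_zero]
    rw [mem_support_quadric]
    rintro (rfl | rfl)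
    · exact Finset.mem_compl.mp hi hc
    · exact hid rfl
  · exact fun h => absurd (Finset.mem_compl.mpr hd) h

/-- If `x_a x_b ∉ I` and no vertex of `W` is a common neighbour of `a` and `b` in the graph of
quadrics not in `I`, then the edge `ab` is a bridge of that graph restricted to `W`. -/
theorem exists_potential (hA : ∀ a ∈ A, a.degree = 2)
    (hI : HasLinearResolution
      (Ideal.span ((fun a => (monomial a (1 : K) : MvPolynomial (Fin n) K)) '' A)) 2)
    {W : Finset (Fin n)} {a b : Fin n} (ha : a ∈ W) (hb : b ∈ W) (hab : a ≠ b)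
    (habA : quadric a b ∉ A)
    (hW : ∀ c ∈ W, c ≠ a → c ≠ b → quadric a c ∈ A ∨ quadric b c ∈ A) :
    ∃ θ : Fin n → K, θ a ≠ θ b ∧ ∀ c ∈ W, ∀ d ∈ W, c ≠ d → quadric c d ∉ A →
      quadric a b ≠ quadric c d → θ c = θ d := by
  obtain ⟨y, hy⟩ := exists_koszulD_coeff hA hI (U := (W.erase a).erase b) (i := a) (j := b)
    (fun c hc => by
      simp only [Finset.mem_erase] at hc
      exact .inr (hW c hc.2.2 hc.2.1 hc.1))
  have key : ∀ c ∈ W, ∀ d ∈ W, c < d →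
      coeff (quadric c d) (koszulD (K := K) y ((W.erase c).erase d)) =
        (koszulSign c W * koszulSign d W) •
          (koszulSign d W • coeff (Finsupp.single d 1) (y (W.erase d)) -
            koszulSign c W • coeff (Finsupp.single c 1) (y (W.erase c))) := by
    intro c hc d hd hcd
    set T := (W.erase c).erase d with hT
    have hdc : d ∈ W.erase c := Finset.mem_erase.mpr ⟨hcd.ne', hd⟩
    have hcT : c ∉ T := by simp [hT]
    have hdT : d ∉ T := by simp [hT]
    have h1 : insert d T = W.erase c := Finset.insert_erase hdc
    have h2 : insert c T = W.erase d := by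
      rw [hT, Finset.erase_right_comm, Finset.insert_erase (Finset.mem_erase.mpr ⟨hcd.ne, hc⟩)]
    have hWT : W = insert c (insert d T) := by rw [h1, Finset.insert_erase hc]
    have hsc : koszulSign c W = koszulSign c T := by
      rw [hWT, koszulSign_insert_of_not_lt (lt_irrefl c), koszulSign_insert_of_not_lt hcd.not_gt]
    have hsd : koszulSign d W = -koszulSign d T := by
      rw [hWT, Finset.insert_comm, koszulSign_insert_of_not_lt (lt_irrefl d),
        koszulSign_insert_of_lt hcT hcd]
    rw [koszulD_coeff_quadric y hcT hdT hcd.ne, h1, h2, smul_sub, smul_smul, smul_smul,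
      mul_assoc, koszulSign_mul_self, mul_right_comm, koszulSign_mul_self, hsc, hsd]
    simp
  have hunit : ∀ c d : Fin n, ∀ x : K, (koszulSign c W * koszulSign d W) • x = 0 → x = 0 := by
    intro c d x hx
    have := congrArg (fun z => (koszulSign d W * koszulSign c W) • z) hx
    simpa only [smul_smul, smul_zero, mul_assoc, koszulSign_mul_self, one_smul,
      ← mul_assoc (koszulSign c W) (koszulSign c W), one_mul] using this
  refine ⟨fun c => koszulSign c W • coeff (Finsupp.single c 1) (y (W.erase c)), ?_, ?_⟩
  · intro heq
    beta_reduce at heq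
    rcases lt_or_gt_of_ne hab with h | h
    · have h1 := key a ha b hb h
      rw [hy _ _ _ habA, heq, sub_self, smul_zero] at h1
      simp at h1
    · have h1 := key b hb a ha h
      rw [hy _ _ _ (quadric_comm a b ▸ habA), heq, sub_self, smul_zero] at h1
      simp [Finset.erase_right_comm, quadric_comm a b] at h1
  · intro c hc d hd hcd hcdA hne
    beta_reduce
    rcases lt_or_gt_of_ne hcd with h | h
    · have h1 := key c hc d hd h
      rw [hy _ _ _ hcdA, if_neg fun h => hne h.2] at h1
      exact (sub_eq_zero.mp (hunit _ _ _ h1.symm)).symm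
    · have h1 := key d hd c hc h
      rw [quadric_comm] at hcdA hne
      rw [quadric_comm c d] at hne
      rw [hy _ _ _ hcdA, if_neg fun h => hne (by rw [← h.2, quadric_comm])] at h1
      exact sub_eq_zero.mp (hunit _ _ _ h1.symm)

theorem quadric_mem_of_squares_mem (hA : ∀ a ∈ A, a.degree = 2)
    (hI : HasLinearResolution
      (Ideal.span ((fun a => (monomial a (1 : K) : MvPolynomial (Fin n) K)) '' A)) 2)
    {i j : Fin n} (hi : quadric i i ∈ A) (hj : quadric j j ∈ A) : quadric i j ∈ A := by
  by_contra hij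
  obtain ⟨y, hy⟩ := exists_koszulD_coeff hA hI (U := {i, j}) (i := i) (j := j)
    (fun c hc => by
      rcases Finset.mem_insert.mp hc with rfl | hc
      · exact .inr (.inl hi)
      · rw [Finset.mem_singleton.mp hc]
        exact .inr (.inr hj))
  have h := hy {i, j} i j hij
  rw [if_pos ⟨rfl, rfl⟩, coeff_koszulD, Finset.sum_eq_zero] at h
  · exact zero_ne_one h
  · intro k hk
    rw [if_neg, smul_zero]
    rw [mem_support_quadric]
    simpa using hk

theorem quadric_notMem_of_square_mem (hA : ∀ a ∈ A, a.degree = 2)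
    (hI : HasLinearResolution
      (Ideal.span ((fun a => (monomial a (1 : K) : MvPolynomial (Fin n) K)) '' A)) 2)
    {i u v : Fin n} (hi : quadric i i ∈ A) (huv : u ≠ v) (hu : quadric i u ∉ A)
    (hv : quadric i v ∉ A) : quadric u v ∉ A := by
  intro huvA
  have hiu : i ≠ u := fun h => hu (h ▸ hi)
  have hiv : i ≠ v := fun h => hv (h ▸ hi)
  obtain ⟨y, hy⟩ := exists_koszulD_coeff hA hI (U := {i, u}) (i := i) (j := v)
    (fun c hc => by
      rcases Finset.mem_insert.mp hc with rfl | hc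
      · exact .inr (.inl hi)
      · rw [Finset.mem_singleton.mp hc, quadric_comm v u]
        exact .inr (.inr huvA))
  have h1 := hy {i, u} i v hv
  have h2 := hy {i, v} i u hu
  rw [koszulD_coeff_quadric_of_mem y (by simp) (by simp [hiv.symm, huv.symm]),
    if_pos ⟨rfl, rfl⟩] at h1
  have hne : quadric i v ≠ quadric i u := fun h => by
    rcases eq_or_eq_of_quadric_eq h with h | h
    · exact huv h.2.symm
    · exact hiu h.1
  rw [koszulD_coeff_quadric_of_mem y (by simp) (by simp [hiu.symm, huv]),
    if_neg fun h => hne h.2] at h2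
  have hset : insert u ({i, v} : Finset (Fin n)) = insert v {i, u} := by
    ext; simp; tauto
  rw [hset] at h2
  have h3 : coeff (Finsupp.single i 1) (y (insert v {i, u})) = 0 := by
    have := congrArg (fun z => koszulSign u {i, v} • z) h2
    simpa only [smul_smul, koszulSign_mul_self, one_smul, smul_zero] using this
  rw [h3, smul_zero] at h1
  exact zero_ne_one h1

end QuadraticMonomialIdeal

section Elimination

variable {V : Type*}

/-- `w` is a simplicial vertex of the subgraph of `G` induced on `U`. -/
def SimpleGraph.IsSimplicialIn (G : SimpleGraph V) (U : Finset V) (w : V) : Prop :=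
  w ∈ U ∧ ∀ x ∈ U, ∀ y ∈ U, G.Adj w x → G.Adj w y → x ≠ y → G.Adj x y

/-- Every edge without common neighbours in an induced subgraph is a bridge of that subgraph,
as witnessed by a potential function. -/
def SimpleGraph.HasBridgePotentials (G : SimpleGraph V) (K : Type*) : Prop :=
  ∀ (W : Finset V) (a b : V), a ∈ W → b ∈ W → G.Adj a b →
    (∀ c ∈ W, ¬ (G.Adj a c ∧ G.Adj b c)) →
    ∃ θ : V → K, θ a ≠ θ b ∧ ∀ c ∈ W, ∀ d ∈ W, G.Adj c d → s(a, b) ≠ s(c, d) → θ c = θ d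

variable {G : SimpleGraph V} {K : Type*}

/-- Two neighbours of `v` that are both adjacent to a connected set `C` of non-neighbours of `v`
are adjacent. -/
theorem SimpleGraph.HasBridgePotentials.adj_of_adj_component (hG : G.HasBridgePotentials K)
    {C : Finset V} {v c₀ s t cs ct : V}
    (hC : ∀ c ∈ C, c ≠ v ∧ ¬ G.Adj v c)
    (hconn : ∀ c ∈ C, Relation.ReflTransGen (fun x y => x ∈ C ∧ y ∈ C ∧ G.Adj x y) c₀ c)
    (hvs : G.Adj v s) (hvt : G.Adj v t) (hcs : cs ∈ C) (hct : ct ∈ C) (hs : G.Adj s cs)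
    (ht : G.Adj t ct) (hst : s ≠ t) : G.Adj s t := by
  classical
  by_contra hnst
  obtain ⟨θ, hθ, hedge⟩ := hG (insert v (insert s (insert t C))) v s (by simp) (by simp) hvs
    (by
      intro c hc
      simp only [Finset.mem_insert] at hc
      rintro ⟨h1, h2⟩
      rcases hc with rfl | rfl | rfl | hc
      · exact G.loopless.irrefl _ h1
      · exact G.loopless.irrefl _ h2
      · exact hnst h2
      · exact (hC c hc).2 h1)
  have hconst : ∀ c ∈ C, θ c₀ = θ c := by
    intro c hc
    induction hconn c hc with
    | refl => rfl
    | tail _ hxy ih =>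
      obtain ⟨hx, hy, hadj⟩ := hxy
      rw [ih hx]
      refine hedge _ (by simp [hx]) _ (by simp [hy]) hadj fun h => ?_
      rw [Sym2.eq_iff] at h
      rcases h with ⟨h1, h2⟩ | ⟨h1, h2⟩
      · exact (hC _ hx).1 h1.symm
      · exact (hC _ hy).1 h1.symm
  have hvt' : θ v = θ t := hedge v (by simp) t (by simp) hvt fun h => by
    rw [Sym2.eq_iff] at h
    rcases h with ⟨h1, h2⟩ | ⟨h1, h2⟩
    · exact hst h2
    · exact hvt.ne h1
  have htc : θ t = θ ct := hedge t (by simp) ct (by simp [hct]) ht fun h => by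
    rw [Sym2.eq_iff] at h
    rcases h with ⟨h1, h2⟩ | ⟨h1, h2⟩
    · exact hvt.ne h1
    · exact (hC _ hct).1 h1.symm
  have hsc : θ s = θ cs := hedge s (by simp) cs (by simp [hcs]) hs fun h => by
    rw [Sym2.eq_iff] at h
    rcases h with ⟨h1, h2⟩ | ⟨h1, h2⟩
    · exact hvs.ne h1
    · exact (hC _ hcs).1 h1.symm
  exact hθ (by rw [hvt', htc, hsc, ← hconst ct hct, hconst cs hcs])

/-- A theorem of Dirac: a vertex that is not adjacent to every other vertex has a simplicial
non-neighbour. -/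
theorem SimpleGraph.HasBridgePotentials.exists_isSimplicialIn_not_adj
    (hG : G.HasBridgePotentials K) (U : Finset V) {v z : V} (hv : v ∈ U) (hz : z ∈ U)
    (hvz : v ≠ z) (hnadj : ¬ G.Adj v z) :
    ∃ w, G.IsSimplicialIn U w ∧ w ≠ v ∧ ¬ G.Adj v w := by
  classical
  induction U using Finset.strongInduction generalizing v z with
  | H U ih =>
  set D := U.filter (fun c => c ≠ v ∧ ¬ G.Adj v c) with hD
  set C := D.filter (fun c => Relation.ReflTransGen (fun x y => x ∈ D ∧ y ∈ D ∧ G.Adj x y) z c)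
    with hCdef
  have hzD : z ∈ D := by simp [hD, hz, hvz.symm, hnadj]
  have hzC : z ∈ C := by
    rw [hCdef, Finset.mem_filter]
    exact ⟨hzD, .refl⟩
  have hCD : ∀ c ∈ C, c ∈ D := fun c hc => (Finset.mem_filter.mp hc).1
  have hCU : ∀ c ∈ C, c ∈ U := fun c hc => (Finset.mem_filter.mp (hCD c hc)).1
  have hCv : ∀ c ∈ C, c ≠ v ∧ ¬ G.Adj v c := fun c hc => (Finset.mem_filter.mp (hCD c hc)).2
  have hclosed : ∀ c ∈ C, ∀ x ∈ U, G.Adj c x → x ∈ C ∨ G.Adj v x := by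
    intro c hc x hx hcx
    by_cases hvx : G.Adj v x
    · exact .inr hvx
    · refine .inl ?_
      have hxD : x ∈ D := by
        refine Finset.mem_filter.mpr ⟨hx, ?_, hvx⟩
        rintro rfl
        exact (hCv c hc).2 hcx.symm
      exact Finset.mem_filter.mpr
        ⟨hxD, (Finset.mem_filter.mp hc).2.tail ⟨hCD c hc, hxD, hcx⟩⟩
  have hconn : ∀ c ∈ C, Relation.ReflTransGen (fun x y => x ∈ C ∧ y ∈ C ∧ G.Adj x y) z c := by
    intro c hc
    have := (Finset.mem_filter.mp hc).2
    clear hc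
    induction this with
    | refl => exact .refl
    | @tail x y hzx hxy ih =>
      exact ih.tail ⟨Finset.mem_filter.mpr ⟨hxy.1, hzx⟩,
        Finset.mem_filter.mpr ⟨hxy.2.1, hzx.tail hxy⟩, hxy.2.2⟩
  set N := U.filter (fun s => G.Adj v s ∧ ∃ c ∈ C, G.Adj s c) with hN
  have hNclique : ∀ s ∈ N, ∀ t ∈ N, s ≠ t → G.Adj s t := by
    intro s hs t ht hst
    obtain ⟨-, hvs, cs, hcs, hscs⟩ := Finset.mem_filter.mp hs
    obtain ⟨-, hvt, ct, hct, htct⟩ := Finset.mem_filter.mp ht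
    exact hG.adj_of_adj_component hCv hconn hvs hvt hcs hct hscs htct hst
  have hnbr : ∀ c ∈ C, ∀ x ∈ U, G.Adj c x → x ∈ C ∪ N := by
    intro c hc x hx hcx
    rcases hclosed c hc x hx hcx with h | h
    · exact Finset.mem_union_left _ h
    · exact Finset.mem_union_right _ (Finset.mem_filter.mpr ⟨hx, h, c, hc, hcx.symm⟩)
  have hsub : C ∪ N ⊂ U := by
    refine (Finset.ssubset_iff_of_subset ?_).mpr ⟨v, hv, ?_⟩
    · intro x hx
      rcases Finset.mem_union.mp hx with h | h
      · exact hCU x h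
      · exact (Finset.mem_filter.mp h).1
    · intro h
      rcases Finset.mem_union.mp h with h | h
      · exact (hCv v h).1 rfl
      · exact G.loopless.irrefl _ (Finset.mem_filter.mp h).2.1
  have hfinish : ∀ w ∈ C, G.IsSimplicialIn (C ∪ N) w →
      ∃ w, G.IsSimplicialIn U w ∧ w ≠ v ∧ ¬ G.Adj v w := fun w hw hsimp =>
    ⟨w, ⟨hCU w hw, fun x hx y hy hwx hwy hxy =>
      hsimp.2 x (hnbr w hw x hx hwx) y (hnbr w hw y hy hwy) hwx hwy hxy⟩, hCv w hw⟩
  by_cases hs : ∃ s ∈ N, ∃ x ∈ C ∪ N, s ≠ x ∧ ¬ G.Adj s x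
  · obtain ⟨s, hsN, x, hx, hsx, hnsx⟩ := hs
    obtain ⟨w, hw, hws, hsw⟩ := ih _ hsub (Finset.mem_union_right _ hsN) hx hsx hnsx
    refine hfinish w ?_ hw
    rcases Finset.mem_union.mp hw.1 with h | h
    · exact h
    · exact absurd (hNclique s hsN w h hws.symm) hsw
  · push Not at hs
    have hCsub : C ⊂ U := Finset.ssubset_of_subset_of_ssubset Finset.subset_union_left hsub
    have hC : ∃ w, G.IsSimplicialIn C w := by
      by_cases hcl : ∃ x ∈ C, ∃ y ∈ C, x ≠ y ∧ ¬ G.Adj x y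
      · obtain ⟨x, hx, y, hy, hxy, hnxy⟩ := hcl
        obtain ⟨w, hw, -⟩ := ih _ hCsub hx hy hxy hnxy
        exact ⟨w, hw⟩
      · push Not at hcl
        exact ⟨z, hzC, fun x hx y hy _ _ hxy => hcl x hx y hy hxy⟩
    obtain ⟨w, hwC, hw⟩ := hC
    refine hfinish w hwC ⟨Finset.mem_union_left _ hwC, fun x hx y hy hwx hwy hxy => ?_⟩
    rcases Finset.mem_union.mp hx with hxC | hxN
    · rcases Finset.mem_union.mp hy with hyC | hyN
      · exact hw x hxC y hyC hwx hwy hxy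
      · exact (hs y hyN x hx hxy.symm).symm
    · exact hs x hxN y hy hxy

theorem SimpleGraph.HasBridgePotentials.exists_isSimplicialIn
    (hG : G.HasBridgePotentials K) {U : Finset V} (hU : U.Nonempty) :
    ∃ w, G.IsSimplicialIn U w := by
  by_cases hcl : ∃ x ∈ U, ∃ y ∈ U, x ≠ y ∧ ¬ G.Adj x y
  · obtain ⟨x, hx, y, hy, hxy, hnxy⟩ := hcl
    obtain ⟨w, hw, -⟩ := hG.exists_isSimplicialIn_not_adj U hx hy hxy hnxy
    exact ⟨w, hw⟩
  · push Not at hcl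
    obtain ⟨z, hz⟩ := hU
    exact ⟨z, hz, fun x hx y hy _ _ hxy => hcl x hx y hy hxy⟩

/-- A perfect elimination ordering that starts with a prescribed set `L` of simplicial
vertices. -/
theorem SimpleGraph.HasBridgePotentials.exists_elimination_order
    (hG : G.HasBridgePotentials K) (L : Set V)
    (hL : ∀ i ∈ L, ∀ x y, G.Adj i x → G.Adj i y → x ≠ y → G.Adj x y) (U : Finset V) :
    ∃ f : V → ℕ, Set.InjOn f U ∧
      (∀ k ∈ U, ∀ x ∈ U, ∀ y ∈ U, f k < f x → f k < f y → G.Adj k x → G.Adj k y → x ≠ y →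
        G.Adj x y) ∧
      ∀ i ∈ U, i ∈ L → ∀ k ∈ U, f k < f i → k ∈ L := by
  classical
  induction U using Finset.strongInduction with
  | H U ih =>
  rcases U.eq_empty_or_nonempty with rfl | hU
  · exact ⟨fun _ => 0, by simp, by simp, by simp⟩
  obtain ⟨w, hw, hwL⟩ : ∃ w, G.IsSimplicialIn U w ∧ (w ∈ L ∨ ∀ i ∈ U, i ∉ L) := by
    by_cases h : ∃ i ∈ U, i ∈ L
    · obtain ⟨i, hi, hiL⟩ := h
      exact ⟨i, ⟨hi, fun x _ y _ => hL i hiL x y⟩, .inl hiL⟩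
    · push Not at h
      obtain ⟨w, hw⟩ := hG.exists_isSimplicialIn hU
      exact ⟨w, hw, .inr h⟩
  obtain ⟨f, hinj, hpeo, hloop⟩ := ih (U.erase w) (Finset.erase_ssubset hw.1)
  have hinj' : ∀ x ∈ U, ∀ y ∈ U, x ≠ w → y ≠ w → f x = f y → x = y :=
    fun x hx y hy hxw hyw h => hinj (by simp [hx, hxw]) (by simp [hy, hyw]) h
  refine ⟨fun x => if x = w then 0 else f x + 1, ?_, ?_, ?_⟩
  · intro x hx y hy hxy
    by_cases hxw : x = w <;> by_cases hyw : y = w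
    · rw [hxw, hyw]
    · simp [hxw, hyw] at hxy
    · simp [hxw, hyw] at hxy
    · exact hinj' x hx y hy hxw hyw (by simpa [hxw, hyw] using hxy)
  · intro k hk x hx y hy hkx hky akx aky hxy
    by_cases hkw : k = w
    · subst hkw
      exact hw.2 x hx y hy akx aky hxy
    · have hxw : x ≠ w := by rintro rfl; simp at hkx
      have hyw : y ≠ w := by rintro rfl; simp at hky
      simp only [hkw, hxw, hyw, if_false, add_lt_add_iff_right] at hkx hky
      exact hpeo k (by simp [hk, hkw]) x (by simp [hx, hxw]) y (by simp [hy, hyw]) hkx hky akx aky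
        hxy
  · intro i hi hiL k hk hki
    by_cases hkw : k = w
    · subst hkw
      exact hwL.resolve_right fun h => h i hi hiL
    · have hiw : i ≠ w := by rintro rfl; simp at hki
      simp only [hkw, hiw, if_false, add_lt_add_iff_right] at hki
      exact hloop i (by simp [hi, hiw]) hiL k (by simp [hk, hkw]) hki

end Elimination

section LexOrder

variable {n : ℕ}

theorem exists_perm_lt_iff {f : Fin n → ℕ} (hf : Function.Injective f) :
    ∃ σ : Equiv.Perm (Fin n), ∀ i j, σ i < σ j ↔ f i < f j := by
  have hmono : StrictMono (f ∘ Tuple.sort f) :=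
    (Tuple.monotone_sort f).strictMono_of_injective (hf.comp (Tuple.sort f).injective)
  refine ⟨(Tuple.sort f)⁻¹, fun i j => ?_⟩
  rw [← hmono.lt_iff_lt]
  simp

theorem toLex_equivMapDomain_lt_iff (σ : Equiv.Perm (Fin n)) (a b : Fin n →₀ ℕ) :
    toLex (Finsupp.equivMapDomain σ a) < toLex (Finsupp.equivMapDomain σ b) ↔
      ∃ v, (∀ w, σ w < σ v → a w = b w) ∧ a v < b v := by
  rw [Finsupp.Lex.lt_iff]
  constructor
  · rintro ⟨v, h1, h2⟩
    refine ⟨σ.symm v, fun w hw => ?_, by simpa using h2⟩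
    simpa using h1 (σ w) (by simpa using hw)
  · rintro ⟨v, h1, h2⟩
    refine ⟨σ v, fun w hw => ?_, by simpa using h2⟩
    simpa using h1 (σ.symm w) (by simpa using hw)

/-- The exchange property behind linear quotients for an elimination order. -/
theorem exists_exchange {A : Set (Fin n →₀ ℕ)} (hA : ∀ a ∈ A, a.degree = 2)
    (hsq : ∀ i j, quadric i i ∈ A → quadric j j ∈ A → quadric i j ∈ A)
    {σ : Equiv.Perm (Fin n)}
    (hpeo : ∀ k x y, σ k < σ x → σ k < σ y → quadric k x ∉ A → quadric k y ∉ A → x ≠ y →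
      quadric x y ∉ A)
    (hloop : ∀ i k, quadric i i ∈ A → σ k < σ i → quadric k k ∈ A)
    {a b e : Fin n →₀ ℕ} (ha : a ∈ A) (hb : b ∈ A)
    (hlt : toLex (Finsupp.equivMapDomain σ a) < toLex (Finsupp.equivMapDomain σ b))
    (hle : b ≤ a + e) :
    ∃ v, e v ≠ 0 ∧ ∃ c ∈ A,
      toLex (Finsupp.equivMapDomain σ a) < toLex (Finsupp.equivMapDomain σ c) ∧
      c ≤ a + Finsupp.single v 1 := by
  obtain ⟨v, hv, hav⟩ := (toLex_equivMapDomain_lt_iff σ a b).mp hlt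
  have hev : e v ≠ 0 := by
    have := hle v
    rw [Finsupp.add_apply] at this
    omega
  refine ⟨v, hev, ?_⟩
  obtain ⟨i, j, rfl⟩ := exists_eq_quadric (hA a ha)
  obtain ⟨l, rfl⟩ : ∃ l, b = quadric v l := by
    obtain ⟨k, l, rfl⟩ := exists_eq_quadric (hA b hb)
    have : v ∈ (quadric k l).support := Finsupp.mem_support_iff.mpr (by omega)
    rcases mem_support_quadric.mp this with rfl | rfl
    · exact ⟨l, rfl⟩
    · exact ⟨k, quadric_comm _ _⟩
  have hle_left : quadric v i ≤ quadric i j + Finsupp.single v 1 := fun k => by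
    simp only [quadric_apply, Finsupp.add_apply, Finsupp.single_apply]
    omega
  have hle_right : quadric v j ≤ quadric i j + Finsupp.single v 1 := fun k => by
    simp only [quadric_apply, Finsupp.add_apply, Finsupp.single_apply]
    omega
  by_cases hli : l = i
  · subst hli
    exact ⟨_, hb, hlt, hle_left⟩
  by_cases hlj : l = j
  · subst hlj
    exact ⟨_, hb, hlt, hle_right⟩
  have hvi : v ≠ i := by
    rintro rfl
    simp only [quadric_apply] at hav
    simp [hli] at hav
  have hvj : v ≠ j := by
    rintro rfl
    simp only [quadric_apply] at hav
    simp [hlj] at hav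
  have hσ : ∀ x, x = i ∨ x = j → v ≠ x → l ≠ x → σ v < σ x := by
    intro x hx hvx hlx
    by_contra hnot
    have hlt' : σ x < σ v := lt_of_le_of_ne (not_lt.mp hnot) fun h => hvx (σ.injective h).symm
    have h := hv x hlt'
    simp only [quadric_apply, hvx, hlx, if_false] at h
    rcases hx with rfl | rfl <;> simp at h
  have hσi := hσ i (.inl rfl) hvi hli
  have hσj := hσ j (.inr rfl) hvj hlj
  have hlex : ∀ x, x = i ∨ x = j →
      toLex (Finsupp.equivMapDomain σ (quadric i j)) <
        toLex (Finsupp.equivMapDomain σ (quadric v x)) := by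
    intro x hx
    refine (toLex_equivMapDomain_lt_iff σ _ _).mpr ⟨v, fun w hw => ?_, ?_⟩
    · have h1 : v ≠ w := by rintro rfl; exact lt_irrefl _ hw
      have h2 : i ≠ w := by rintro rfl; exact lt_asymm hw hσi
      have h3 : j ≠ w := by rintro rfl; exact lt_asymm hw hσj
      have h4 : x ≠ w := by rcases hx with rfl | rfl <;> assumption
      simp [quadric_apply, h1, h2, h3, h4]
    · simp [quadric_apply, hvi.symm, hvj.symm]
  by_cases h1 : quadric v i ∈ A
  · exact ⟨_, h1, hlex i (.inl rfl), hle_left⟩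
  by_cases h2 : quadric v j ∈ A
  · exact ⟨_, h2, hlex j (.inr rfl), hle_right⟩
  exfalso
  by_cases hij : i = j
  · subst hij
    exact h1 (hsq v i (hloop i v ha hσi) ha)
  · exact hpeo v i j hσi hσj h1 h2 hij ha

/-- A monomial ideal with the variable exchange property has colon ideals generated by
variables. -/
theorem colon_span_monomial_eq_span_X {K : Type*} [Field K] {B : Set (Fin n →₀ ℕ)}
    {a : Fin n →₀ ℕ}
    (h : ∀ b ∈ B, ∀ e, b ≤ a + e → ∃ v, e v ≠ 0 ∧ ∃ c ∈ B, c ≤ a + Finsupp.single v 1) :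
    Submodule.colon
        (Ideal.span ((fun b => (monomial b (1 : K) : MvPolynomial (Fin n) K)) '' B))
        (Ideal.span {(monomial a (1 : K) : MvPolynomial (Fin n) K)}) =
      Ideal.span ((fun x => (X x : MvPolynomial (Fin n) K)) ''
        {v | ∃ c ∈ B, c ≤ a + Finsupp.single v 1}) := by
  apply le_antisymm
  · intro p hp
    rw [Ideal.span, Submodule.mem_colon_span_singleton, smul_eq_mul] at hp
    refine mem_ideal_span_X_image.mpr fun e he => ?_
    obtain ⟨b, hb, hle⟩ := mem_ideal_span_monomial_image.mp hp (e + a) (by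
      rw [mem_support_iff, coeff_mul_monomial, mul_one]
      exact mem_support_iff.mp he)
    obtain ⟨v, hv, hc⟩ := h b hb e (by rwa [add_comm])
    exact ⟨v, hc, hv⟩
  · rw [Ideal.span_le]
    rintro _ ⟨v, ⟨c, hc, hle⟩, rfl⟩
    rw [SetLike.mem_coe, Ideal.span, Submodule.mem_colon_span_singleton, smul_eq_mul]
    beta_reduce
    rw [X, monomial_mul]
    refine mem_ideal_span_monomial_image.mpr fun b hb => ⟨c, hc, ?_⟩
    obtain rfl : b = Finsupp.single v 1 + a := by simpa using support_monomial_subset hb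
    rwa [add_comm]

end LexOrder

/-- Let `I` be a quadratic monomial ideal with linear resolution, with minimal monomial
generating set `A` (given by exponent vectors).  Then, after a suitable relabelling `σ`
of the variables, `I` has linear quotients with respect to the lexicographic order
(induced by `x_1 > ... > x_n`) on its minimal generators: for each generator `a`, the
colon ideal of the span of the lex-larger generators by `a` is generated by variables. -/
theorem linearQuotients_lex_of_quadratic {K : Type*} [Field K] {n : ℕ}
    (I : Ideal (MvPolynomial (Fin n) K)) (A : Set (Fin n →₀ ℕ))
    (hdeg : ∀ a ∈ A, a.sum (fun _ e => e) = 2)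
    (hgen : I = Ideal.span ((fun a => (monomial a (1 : K) : MvPolynomial (Fin n) K)) '' A))
    (hmin : ∀ a ∈ A, ∀ b ∈ A, a ≤ b → a = b)
    (hlin : HasLinearResolution I 2) :
    ∃ σ : Equiv.Perm (Fin n), ∀ a ∈ A, ∃ s : Set (Fin n),
      Submodule.colon
          (Ideal.span ((fun b => (monomial (Finsupp.equivMapDomain σ b) (1 : K) :
              MvPolynomial (Fin n) K)) ''
            {b | b ∈ A ∧ toLex (Finsupp.equivMapDomain σ a)
              < toLex (Finsupp.equivMapDomain σ b)}))
          (Ideal.span {(monomial (Finsupp.equivMapDomain σ a) (1 : K) :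
              MvPolynomial (Fin n) K)})
        = Ideal.span ((fun x => (X x : MvPolynomial (Fin n) K)) '' s) := by
  classical
  subst hgen
  have hA : ∀ a ∈ A, a.degree = 2 := hdeg
  let G : SimpleGraph (Fin n) :=
    { Adj := fun i j => i ≠ j ∧ quadric i j ∉ A
      symm := ⟨fun i j h => ⟨h.1.symm, quadric_comm i j ▸ h.2⟩⟩
      loopless := ⟨fun _ h => h.1 rfl⟩ }
  have hG : G.HasBridgePotentials K := by
    intro W a b ha hb hab hW
    obtain ⟨θ, hθ, hedge⟩ := exists_potential hA hlin ha hb hab.1 hab.2 (fun c hc hca hcb => by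
      by_contra! h
      exact hW c hc ⟨⟨hca.symm, h.1⟩, ⟨hcb.symm, h.2⟩⟩)
    refine ⟨θ, hθ, fun c hc d hd hcd hne => hedge c hc d hd hcd.1 hcd.2 fun h => hne ?_⟩
    rw [Sym2.eq_iff]
    exact eq_or_eq_of_quadric_eq h
  obtain ⟨f, hinj, hpeo, hloop⟩ := hG.exists_elimination_order {i | quadric i i ∈ A}
    (fun i hi x y hx hy hxy => ⟨hxy, quadric_notMem_of_square_mem hA hlin hi hxy hx.2 hy.2⟩)
    Finset.univ
  obtain ⟨σ, hσ⟩ := exists_perm_lt_iff (f := f) (fun x y h => hinj (by simp) (by simp) h)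
  refine ⟨σ, fun a ha => ?_⟩
  rw [← Set.image_image (fun b => (monomial b (1 : K) : MvPolynomial (Fin n) K))
    (Finsupp.equivMapDomain σ)]
  refine ⟨_, colon_span_monomial_eq_span_X ?_⟩
  rintro _ ⟨b, ⟨hb, hlt⟩, rfl⟩ e hle
  obtain ⟨v, hv, c, hc, hac, hcle⟩ := exists_exchange hA
    (fun i j => quadric_mem_of_squares_mem hA hlin) (σ := σ)
    (fun k x y hkx hky h1 h2 hxy => (hpeo k (by simp) x (by simp) y (by simp)
      ((hσ _ _).mp hkx) ((hσ _ _).mp hky) ⟨fun h => by simp [h] at hkx, h1⟩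
      ⟨fun h => by simp [h] at hky, h2⟩ hxy).2)
    (fun i k hi hki => hloop i (by simp) hi k (by simp) ((hσ _ _).mp hki))
    (e := Finsupp.equivMapDomain σ.symm e) ha hb hlt
    (fun x => by simpa using hle (σ x))
  refine ⟨σ v, by simpa using hv, _, ⟨c, ⟨hc, hac⟩, rfl⟩, fun x => ?_⟩
  have := hcle (σ.symm x)
  simpa [Finsupp.single_apply, Equiv.eq_symm_apply] using this
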